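/- arXiv:quant-ph/0507190 — 2 statements merged into one kernel-verified Lean document; each statement's English description precedes it below -/
import Mathlib

section
/- Let N, M, k ≥ 1 be integers. Then (1/N^(k+1)) · Σ_{x ∈ (ℤ/Nℤ)ᵏ} Σ_{w ∈ ℤ/Nℤ} (η^x_w)² ≥ M^k/N + M^k(M^k − 1)/N². -/
/-- `η^x_w` is the number of `b ∈ {0,…,M-1}^k` with `b₁x₁ + ⋯ + b_kx_k ≡ w (mod N)`. -/
def eta (N M k : ℕ) (x : Fin k → ZMod N) (w : ZMod N) : ℕ :=
  (Finset.univ.filter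
    (fun b : Fin k → Fin M => ∑ i, ((b i : ℕ) : ZMod N) * x i = w)).card

/-- A linear form on `(ZMod N)^k` vanishes on at least a proportion `1 / N` of the vectors. -/
theorem pow_le_mul_card_linear_form_eq_zero (N k : ℕ) [NeZero N] (c : Fin k → ZMod N) :
    N ^ k ≤ N * (Finset.univ.filter (fun x : Fin k → ZMod N => ∑ i, c i * x i = 0)).card := by
  let f : (Fin k → ZMod N) →+ ZMod N :=
    { toFun := fun x => ∑ i, c i * x i
      map_zero' := by simp
      map_add' := fun x y => by simp [mul_add, Finset.sum_add_distrib] }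
  have hcard := AddSubgroup.card_mul_index f.ker
  rw [AddSubgroup.index_ker] at hcard
  have hker : Nat.card f.ker =
      (Finset.univ.filter (fun x : Fin k → ZMod N => ∑ i, c i * x i = 0)).card :=
    Nat.subtype_card _ fun x => by simp [f, AddMonoidHom.mem_ker]
  have hrange : Nat.card f.range ≤ N :=
    (Finite.card_subtype_le _).trans_eq (Nat.card_zmod N)
  calc N ^ k = Nat.card (Fin k → ZMod N) := by simp
    _ = Nat.card f.ker * Nat.card f.range := hcard.symm
    _ ≤ Nat.card f.ker * N := Nat.mul_le_mul_left _ hrange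
    _ = _ := by rw [hker, mul_comm]

/-- The sum of the squared fibre sizes of a map counts the pairs with equal images. -/
theorem sum_card_fiber_sq {α β : Type*} [Fintype α] [Fintype β] [DecidableEq β] (g : α → β) :
    ∑ w, (Finset.univ.filter (fun a => g a = w)).card ^ 2 =
      ∑ a, ∑ a', if g a = g a' then 1 else 0 := by
  simp_rw [Finset.card_filter, sq, Finset.sum_mul_sum]
  rw [Finset.sum_comm]
  refine Finset.sum_congr rfl fun a _ => ?_
  rw [Finset.sum_comm]
  refine Finset.sum_congr rfl fun a' _ => ?_
  simp [eq_comm]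

/-- The second moment of `η` counts, over all pairs `(b, b')`, the vectors orthogonal to
`b - b'`. -/
theorem sum_eta_sq (N M k : ℕ) [NeZero N] :
    ∑ x : Fin k → ZMod N, ∑ w : ZMod N, eta N M k x w ^ 2 =
      ∑ b : Fin k → Fin M, ∑ b' : Fin k → Fin M,
        (Finset.univ.filter (fun x : Fin k → ZMod N =>
          ∑ i, (((b i : ℕ) : ZMod N) - ((b' i : ℕ) : ZMod N)) * x i = 0)).card := by
  simp_rw [eta, sum_card_fiber_sq, Finset.card_filter, sub_mul, Finset.sum_sub_distrib,
    sub_eq_zero]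
  rw [Finset.sum_comm]
  exact Finset.sum_congr rfl fun b _ => Finset.sum_comm

/-- The second moment of `η^x_w` is at least `M^k/N + M^k(M^k - 1)/N²`. -/
theorem eta_second_moment_lower_bound (N M k : ℕ) [NeZero N] (hM : 1 ≤ M) (hk : 1 ≤ k) :
    (M : ℝ) ^ k / N + (M : ℝ) ^ k * ((M : ℝ) ^ k - 1) / (N : ℝ) ^ 2 ≤
      (1 / (N : ℝ) ^ (k + 1)) *
        ∑ x : Fin k → ZMod N, ∑ w : ZMod N, (eta N M k x w : ℝ) ^ 2 := by
  have hN : (0 : ℝ) < N := by exact_mod_cast NeZero.pos N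
  have hsum : ∑ x : Fin k → ZMod N, ∑ w : ZMod N, (eta N M k x w : ℝ) ^ 2 =
      ∑ b : Fin k → Fin M, ∑ b' : Fin k → Fin M,
        ((Finset.univ.filter (fun x : Fin k → ZMod N =>
          ∑ i, (((b i : ℕ) : ZMod N) - ((b' i : ℕ) : ZMod N)) * x i = 0)).card : ℝ) := by
    exact_mod_cast sum_eta_sq N M k
  have hpair (b b' : Fin k → Fin M) :
      (N : ℝ) ^ k / N + (if b = b' then (N : ℝ) ^ k - (N : ℝ) ^ k / N else 0) ≤
        ((Finset.univ.filter (fun x : Fin k → ZMod N =>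
          ∑ i, (((b i : ℕ) : ZMod N) - ((b' i : ℕ) : ZMod N)) * x i = 0)).card : ℝ) := by
    split_ifs with h
    · simp [h]
    · rw [add_zero, div_le_iff₀' hN]
      exact_mod_cast pow_le_mul_card_linear_form_eq_zero N k _
  have hlower := Finset.sum_le_sum fun b (_ : b ∈ Finset.univ) =>
    Finset.sum_le_sum fun b' (_ : b' ∈ Finset.univ) => hpair b b'
  rw [← hsum] at hlower
  refine le_trans (le_of_eq ?_) (mul_le_mul_of_nonneg_left hlower (by positivity))
  simp only [Finset.sum_add_distrib, Finset.sum_ite_eq, Finset.mem_univ, if_true,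
    Finset.sum_const, Finset.card_univ, Fintype.card_fun, Fintype.card_fin, nsmul_eq_mul,
    Nat.cast_pow]
  field_simp
  ring
end

section
/- Fix an integer k ≥ 3 and set M = M(N) := ⌊N^(1/k)⌋. Then for every ε > 0 there exists N₀ such that for all N ≥ N₀, the number of pairs (x,w) ∈ (ℤ/Nℤ)ᵏ × (ℤ/Nℤ) with η^x_w = 0 is at most (π²/12 + ε) · N^(k+1). -/
/-- `Mfl k N = ⌊N^(1/k)⌋`, the integer part of the real `k`-th root of `N`. -/
noncomputable def Mfl (k N : ℕ) : ℕ := Nat.floor ((N : ℝ) ^ ((1 : ℝ) / k))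

open Finset Filter Topology

theorem sum_sq_card_fiber {α β : Type*} [Fintype α] [Fintype β] [DecidableEq β] (f : α → β) :
    ∑ w, #{b | f b = w} ^ 2 = #{p : α × α | f p.1 = f p.2} := by
  rw [card_eq_sum_card_fiberwise (f := fun p : α × α => f p.1) (t := univ) (by simp)]
  refine sum_congr rfl fun w _ => ?_
  rw [sq, ← card_product]
  congr 1
  ext ⟨b, c⟩
  simp only [mem_product, mem_filter, mem_univ, true_and]
  grind

theorem card_linear_relation_mul_le {ι : Type*} [Fintype ι] [DecidableEq ι] (N : ℕ) [NeZero N]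
    (d : ι → ℤ) {g : ℕ} (hg : univ.gcd d = g) (hgpos : 0 < g) :
    #{x : ι → ZMod N | ∑ i, (d i : ZMod N) * x i = 0} * N ≤ N ^ Fintype.card ι * g := by
  let φ : (ι → ZMod N) →+ ZMod N :=
    { toFun := fun x => ∑ i, (d i : ZMod N) * x i
      map_zero' := by simp
      map_add' := fun x y => by simp [mul_add, sum_add_distrib] }
  have hker : #{x : ι → ZMod N | ∑ i, (d i : ZMod N) * x i = 0} = Nat.card φ.ker := by
    rw [← Fintype.card_subtype, ← Nat.card_eq_fintype_card]
    rfl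
  have hmem : (g : ZMod N) ∈ φ.range := by
    obtain ⟨c, hc⟩ := univ.gcd_eq_sum_mul d
    refine ⟨fun i => (c i : ZMod N), ?_⟩
    rw [hg] at hc
    simpa [φ] using (congrArg (Int.cast : ℤ → ZMod N) hc).symm
  have hord : addOrderOf (g : ZMod N) ≤ Nat.card φ.range := by
    have := addOrderOf_le_card (x := (⟨(g : ZMod N), hmem⟩ : φ.range))
    rwa [← AddSubgroup.addOrderOf_coe] at this
  have hN : N ≤ addOrderOf (g : ZMod N) * g := by
    refine Nat.le_of_dvd (Nat.mul_pos (addOrderOf_pos _) hgpos) ?_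
    rw [← ZMod.natCast_eq_zero_iff]
    simpa using addOrderOf_nsmul_eq_zero (g : ZMod N)
  have hcard : Nat.card φ.ker * Nat.card φ.range = N ^ Fintype.card ι := by
    rw [← AddSubgroup.index_ker, AddSubgroup.card_mul_index]
    simp
  calc _ = Nat.card φ.ker * N := by rw [hker]
    _ ≤ Nat.card φ.ker * (Nat.card φ.range * g) := by
      gcongr
      exact hN.trans (by gcongr)
    _ = _ := by rw [← hcard, mul_assoc]

theorem card_fin_modEq_le (M e v : ℕ) (he : 0 < e) :
    #{c : Fin M | (c : ℕ) ≡ v [MOD e]} ≤ M / e + 1 := by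
  have h : #{c : Fin M | (c : ℕ) ≡ v [MOD e]} = Nat.count (· ≡ v [MOD e]) M := by
    rw [Nat.count_eq_card_filter_range, ← card_map Fin.valEmbedding]
    congr 1
    ext a
    simp [Fin.exists_iff, and_comm]
  rw [h, Nat.count_modEq_card _ he]
  split_ifs <;> omega

theorem card_pi_modEq_le {ι : Type*} [Fintype ι] [DecidableEq ι] (M e : ℕ) (he : 0 < e) :
    #{p : (ι → Fin M) × (ι → Fin M) | ∀ i, (p.1 i : ℕ) ≡ p.2 i [MOD e]} ≤
      M ^ Fintype.card ι * (M / e + 1) ^ Fintype.card ι := by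
  rw [card_eq_sum_card_fiberwise (f := fun p : (ι → Fin M) × (ι → Fin M) => p.2) (t := univ)
    (by simp)]
  have hfib (b : ι → Fin M) :
      #{p ∈ {p : (ι → Fin M) × (ι → Fin M) | ∀ i, (p.1 i : ℕ) ≡ p.2 i [MOD e]} | p.2 = b} ≤
        (M / e + 1) ^ Fintype.card ι := by
    calc _ ≤ #(Fintype.piFinset fun i => {c : Fin M | (c : ℕ) ≡ b i [MOD e]}) := by
          refine card_le_card_of_injOn Prod.fst ?_ ?_
          · rintro ⟨p, q⟩ h
            simp only [coe_filter, mem_filter, mem_univ, true_and, Set.mem_ofPred_eq] at h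
            simpa [h.2] using h.1
          · rintro ⟨p, q⟩ h ⟨p', q'⟩ h' hp
            simp only [coe_filter, mem_filter, mem_univ, true_and, Set.mem_ofPred_eq] at h h' hp
            simp [h.2, h'.2, hp]
      _ ≤ _ := by
          rw [Fintype.card_piFinset]
          exact (prod_le_prod' fun i _ => card_fin_modEq_le M e (b i) he).trans (by simp)
  exact (sum_le_sum fun b _ => hfib b).trans (by simp)

theorem card_coincidence_mul_le {k : ℕ} (N M : ℕ) [NeZero N]
    (p : (Fin k → Fin M) × (Fin k → Fin M)) :
    #{x : Fin k → ZMod N |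
        ∑ i, ((p.1 i : ℕ) : ZMod N) * x i = ∑ i, ((p.2 i : ℕ) : ZMod N) * x i} * N ≤
      (if p.1 = p.2 then N ^ (k + 1) else 0) +
        N ^ k * ∑ e ∈ Ico 1 M, if ∀ i, (p.1 i : ℕ) ≡ p.2 i [MOD e] then e else 0 := by
  split_ifs with h
  · refine le_add_right ?_
    rw [pow_succ]
    gcongr
    exact (card_le_univ _).trans (by simp)
  rw [zero_add]
  set d : Fin k → ℤ := fun i => (p.2 i : ℤ) - (p.1 i : ℤ) with hd
  obtain ⟨g, hg⟩ := Int.eq_ofNat_of_zero_le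
    (Int.nonneg_of_normalize_eq_self (univ.normalize_gcd (f := d)))
  obtain ⟨j, hj⟩ := Function.ne_iff.mp h
  have hdj : d j ≠ 0 := by
    have := Fin.val_ne_of_ne hj
    simp only [hd]
    omega
  have hdvd (i) : (g : ℤ) ∣ d i := hg ▸ Finset.gcd_dvd (mem_univ i)
  have hgpos : 0 < g := by
    rcases Nat.eq_zero_or_pos g with rfl | h0
    · exact absurd (by simpa using hdvd j) hdj
    · exact h0
  have hgM : g < M := by
    have h1 := Int.le_of_dvd (abs_pos.mpr hdj) ((dvd_abs _ _).mpr (hdvd j))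
    have h2 : |d j| < M := by
      rw [abs_lt]
      simp only [hd]
      omega
    omega
  have hcong (i) : (p.1 i : ℕ) ≡ p.2 i [MOD g] := (Nat.modEq_iff_dvd).mpr (hdvd i)
  have hle : g ≤ ∑ e ∈ Ico 1 M, if ∀ i, (p.1 i : ℕ) ≡ p.2 i [MOD e] then e else 0 := by
    refine le_trans ?_ (single_le_sum (fun _ _ => Nat.zero_le _) (mem_Ico.mpr ⟨hgpos, hgM⟩))
    rw [if_pos hcong]
  calc _ = #{x : Fin k → ZMod N | ∑ i, (d i : ZMod N) * x i = 0} * N := by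
        congr 2
        ext x
        simp only [hd, Int.cast_sub, Int.cast_natCast, sub_mul, sum_sub_distrib, sub_eq_zero,
          mem_filter, mem_univ, true_and]
        exact eq_comm
    _ ≤ N ^ k * g := by simpa using card_linear_relation_mul_le N d hg hgpos
    _ ≤ _ := by gcongr

theorem sum_eta (N M k : ℕ) [NeZero N] (x : Fin k → ZMod N) : ∑ w, eta N M k x w = M ^ k := by
  unfold eta
  rw [← card_eq_sum_card_fiberwise (by simp)]
  simp

theorem sum_eta_sq_mul_le (N M k : ℕ) [NeZero N] :
    (∑ x, ∑ w, eta N M k x w ^ 2) * N ≤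
      M ^ k * N ^ (k + 1) + N ^ k * ∑ e ∈ Ico 1 M, M ^ k * (M / e + 1) ^ k * e := by
  unfold eta
  simp_rw [sum_sq_card_fiber]
  have hswap := sum_card_bipartiteAbove_eq_sum_card_bipartiteBelow
    (fun (x : Fin k → ZMod N) (p : (Fin k → Fin M) × (Fin k → Fin M)) =>
      ∑ i, ((p.1 i : ℕ) : ZMod N) * x i = ∑ i, ((p.2 i : ℕ) : ZMod N) * x i)
    (s := univ) (t := univ)
  simp only [bipartiteAbove, bipartiteBelow] at hswap
  rw [hswap, sum_mul]
  refine (sum_le_sum fun p _ => card_coincidence_mul_le N M p).trans ?_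
  rw [sum_add_distrib, ← mul_sum, sum_comm]
  gcongr with e he
  · rw [Fintype.sum_prod_type]
    simp
  · rw [← sum_filter, sum_const, smul_eq_mul]
    gcongr
    have h := card_pi_modEq_le (ι := Fin k) M e (mem_Ico.mp he).1
    rw [Fintype.card_fin] at h
    exact le_of_eq_of_le (by congr) h

theorem two_mul_card_eta_eq_zero_add_le (N M k : ℕ) [NeZero N] :
    2 * #{p : (Fin k → ZMod N) × ZMod N | eta N M k p.1 p.2 = 0} + 3 * (M ^ k * N ^ k) ≤
      (∑ x, ∑ w, eta N M k x w ^ 2) + 2 * N ^ (k + 1) := by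
  have h1 : ∑ p : (Fin k → ZMod N) × ZMod N, eta N M k p.1 p.2 = M ^ k * N ^ k := by
    rw [Fintype.sum_prod_type]
    simp [sum_eta, mul_comm]
  have h2 : ∑ p : (Fin k → ZMod N) × ZMod N, 1 = N ^ (k + 1) := by
    simp [pow_succ]
  rw [card_filter, ← h1, ← h2, ← Fintype.sum_prod_type', mul_sum, mul_sum, mul_sum,
    ← sum_add_distrib, ← sum_add_distrib]
  refine sum_le_sum fun p _ => ?_
  generalize eta N M k p.1 p.2 = n
  split_ifs with h
  · simp [h]
  · rcases Nat.lt_or_ge n 2 with h2 | h2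
    · interval_cases n <;> simp at h ⊢
    · nlinarith

/-- The sum bounding the off-diagonal second moment, after normalisation by `M ^ (2 * k)`. -/
noncomputable def congruenceSum (k M : ℕ) : ℝ :=
  ∑ e ∈ Ico 1 M, (e : ℝ) * (1 / e + 1 / M) ^ k

theorem card_eta_eq_zero_le (N M k : ℕ) [NeZero N] :
    (#{p : (Fin k → ZMod N) × ZMod N | eta N M k p.1 p.2 = 0} : ℝ) ≤
      (((M : ℝ) ^ k / N) ^ 2 * congruenceSum k M / 2 - (M : ℝ) ^ k / N + 1) * (N : ℝ) ^ (k + 1) := by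
  have hN : (0 : ℝ) < N := by exact_mod_cast Nat.pos_of_neZero N
  have h1 : (2 * #{p : (Fin k → ZMod N) × ZMod N | eta N M k p.1 p.2 = 0} +
      3 * ((M : ℝ) ^ k * N ^ k)) ≤ ((∑ x, ∑ w, eta N M k x w ^ 2 : ℕ) : ℝ) + 2 * N ^ (k + 1) := by
    exact_mod_cast two_mul_card_eta_eq_zero_add_le N M k
  have h2 : ((∑ x, ∑ w, eta N M k x w ^ 2 : ℕ) : ℝ) * N ≤
      (M : ℝ) ^ k * N ^ (k + 1) +
        N ^ k * ((∑ e ∈ Ico 1 M, M ^ k * (M / e + 1) ^ k * e : ℕ) : ℝ) := by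
    exact_mod_cast sum_eta_sq_mul_le N M k
  have h3 : ((∑ e ∈ Ico 1 M, M ^ k * (M / e + 1) ^ k * e : ℕ) : ℝ) ≤
      (M : ℝ) ^ k * M ^ k * congruenceSum k M := by
    unfold congruenceSum
    push_cast
    rw [mul_sum]
    refine sum_le_sum fun e he => ?_
    have hM : (0 : ℝ) < M := by
      have := mem_Ico.mp he
      exact_mod_cast (by omega : 0 < M)
    have hdiv : (((M / e : ℕ) : ℝ) + 1) ≤ M * (1 / e + 1 / M) := by
      have := Nat.cast_div_le (α := ℝ) (m := M) (n := e)
      rw [mul_add, mul_one_div, mul_one_div, div_self hM.ne']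
      linarith
    calc (M : ℝ) ^ k * (((M / e : ℕ) : ℝ) + 1) ^ k * e
        ≤ (M : ℝ) ^ k * (M * (1 / e + 1 / M)) ^ k * e := by gcongr
      _ = _ := by rw [mul_pow]; ring
  set S := ((∑ x, ∑ w, eta N M k x w ^ 2 : ℕ) : ℝ)
  have h4 : S * N ≤ (M : ℝ) ^ k * N ^ (k + 1) + N ^ k * ((M : ℝ) ^ k * M ^ k * congruenceSum k M) :=
    h2.trans (by gcongr)
  have h5 : S ≤ (M : ℝ) ^ k * N ^ k +
      ((M : ℝ) ^ k / N) ^ 2 * congruenceSum k M * N ^ (k + 1) := by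
    rw [← mul_le_mul_iff_left₀ hN]
    refine h4.trans_eq ?_
    field_simp
    ring
  have h6 : (M : ℝ) ^ k / N * N ^ (k + 1) = M ^ k * N ^ k := by
    field_simp
    ring
  linear_combination h1 / 2 + h5 / 2 + h6

theorem tendsto_congruenceSum {k : ℕ} (hk : 3 ≤ k) :
    Tendsto (congruenceSum k) atTop (𝓝 (∑' e : ℕ, (e : ℝ) * (1 / e) ^ k)) := by
  have hsum (M : ℕ) : congruenceSum k M =
      ∑' e : ℕ, if e ∈ Ico 1 M then (e : ℝ) * (1 / e + 1 / M) ^ k else 0 := by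
    rw [tsum_eq_sum (s := Ico 1 M) (fun e he => if_neg he)]
    exact sum_congr rfl fun e he => (if_pos he).symm
  simp_rw [funext hsum]
  refine tendsto_tsum_of_dominated_convergence
    (bound := fun e : ℕ => 2 ^ k * (1 / (e : ℝ) ^ 2)) (hasSum_zeta_two.summable.mul_left _) ?_ ?_
  · intro e
    rcases Nat.eq_zero_or_pos e with rfl | he
    · simp
    · have h : Tendsto (fun M : ℕ => (e : ℝ) * (1 / e + 1 / M) ^ k) atTop
          (𝓝 ((e : ℝ) * (1 / e + 0) ^ k)) :=
        ((tendsto_one_div_atTop_nhds_zero_nat.const_add _).pow k).const_mul _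
      rw [add_zero] at h
      refine h.congr' ?_
      filter_upwards [eventually_gt_atTop e] with M hM
      rw [if_pos (mem_Ico.mpr ⟨he, hM⟩)]
  · refine Eventually.of_forall fun M e => ?_
    split_ifs with h
    · obtain ⟨h1, h2⟩ := mem_Ico.mp h
      have he : (1 : ℝ) ≤ e := by exact_mod_cast h1
      have he0 : (0 : ℝ) < e := by linarith
      rw [Real.norm_of_nonneg (by positivity)]
      calc (e : ℝ) * (1 / e + 1 / M) ^ k ≤ e * (1 / e + 1 / e) ^ k := by gcongr
        _ = 2 ^ k * (e * (1 / e) ^ k) := by rw [← two_mul, mul_pow]; ring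
        _ ≤ 2 ^ k * (e * (1 / e) ^ 3) := by
            gcongr 2 ^ k * (e * ?_)
            exact pow_le_pow_of_le_one (by positivity) ((div_le_one he0).mpr he) hk
        _ = _ := by field_simp
    · simp only [norm_zero]
      positivity

theorem tsum_mul_one_div_pow_le {k : ℕ} (hk : 3 ≤ k) :
    ∑' e : ℕ, (e : ℝ) * (1 / e) ^ k ≤ Real.pi ^ 2 / 6 := by
  have hle (e : ℕ) : (e : ℝ) * (1 / e) ^ k ≤ 1 / (e : ℝ) ^ 2 := by
    rcases Nat.eq_zero_or_pos e with rfl | h1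
    · simp
    · have he : (1 : ℝ) ≤ e := by exact_mod_cast h1
      have he0 : (0 : ℝ) < e := by linarith
      calc (e : ℝ) * (1 / e) ^ k ≤ e * (1 / e) ^ 3 := by
            gcongr (e : ℝ) * ?_
            exact pow_le_pow_of_le_one (by positivity) ((div_le_one he0).mpr he) hk
        _ = _ := by field_simp
  rw [← hasSum_zeta_two.tsum_eq]
  exact Summable.tsum_le_tsum hle
    (hasSum_zeta_two.summable.of_nonneg_of_le (fun e => by positivity) hle)
    hasSum_zeta_two.summable

theorem tendsto_rpow_one_div_natCast {k : ℕ} (hk : k ≠ 0) :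
    Tendsto (fun N : ℕ => (N : ℝ) ^ ((1 : ℝ) / k)) atTop atTop :=
  (tendsto_rpow_atTop (by positivity)).comp tendsto_natCast_atTop_atTop

theorem tendsto_Mfl {k : ℕ} (hk : k ≠ 0) : Tendsto (Mfl k) atTop atTop :=
  tendsto_nat_floor_atTop.comp (tendsto_rpow_one_div_natCast hk)

theorem tendsto_Mfl_pow_div {k : ℕ} (hk : k ≠ 0) :
    Tendsto (fun N : ℕ => (Mfl k N : ℝ) ^ k / N) atTop (𝓝 1) := by
  have h := (tendsto_nat_floor_div_atTop.comp (tendsto_rpow_one_div_natCast hk)).pow k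
  rw [one_pow] at h
  refine h.congr fun N => ?_
  simp only [Function.comp_apply, div_pow, Mfl, one_div]
  rw [Real.rpow_inv_natCast_pow (by positivity) hk]

/-- For fixed `k ≥ 3` and `M = ⌊N^(1/k)⌋`, the number of pairs `(x, w)` with
`η^x_w = 0` is at most `(π²/12 + ε) N^(k+1)` for all sufficiently large `N`. -/
theorem eta_few_zero_instances (k : ℕ) (hk : 3 ≤ k) (ε : ℝ) (hε : 0 < ε) :
    ∃ N₀ : ℕ, ∀ (N : ℕ) [NeZero N], N₀ ≤ N →
      (((Finset.univ : Finset ((Fin k → ZMod N) × ZMod N)).filter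
          (fun p => eta N (Mfl k N) k p.1 p.2 = 0)).card : ℝ) ≤
        (Real.pi ^ 2 / 12 + ε) * (N : ℝ) ^ (k + 1) := by
  have hk0 : k ≠ 0 := by omega
  have hμ := tendsto_Mfl_pow_div hk0
  have hlim := ((((hμ.pow 2).mul ((tendsto_congruenceSum hk).comp (tendsto_Mfl hk0))).div_const
    2).sub hμ).add_const 1
  have hζ := tsum_mul_one_div_pow_le hk
  obtain ⟨N₀, hN₀⟩ := eventually_atTop.mp
    (hlim.eventually_le_const (u := Real.pi ^ 2 / 12 + ε) (by linarith))
  refine ⟨N₀, fun N _ hN => (card_eta_eq_zero_le N (Mfl k N) k).trans ?_⟩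
  exact mul_le_mul_of_nonneg_right (hN₀ N hN) (by positivity)
end
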